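/- Let d ≥ 1 be an integer and let t_1 < t_2 < … < t_{d+2} be real numbers. Then ∑_{i odd, 1 ≤ i ≤ d+2} V_i = ∑_{i even, 1 ≤ i ≤ d+2} V_i, where V_i := ∏_{1 ≤ k < ℓ ≤ d+2, k ≠ i, ℓ ≠ i} (t_ℓ − t_k); equivalently ∑_{i=1}^{d+2} (−1)^i V_i = 0. (This expresses that the lower and the upper triangulation of C(d+2, d) have the same total normalized volume, namely that of the polytope they both subdivide.) -/

import Mathlib

open Finset

/-- The `d`-th moment curve `t ↦ (t, t², …, t^d)` in `ℝ^d`. -/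
noncomputable def moment (d : ℕ) (s : ℝ) : Fin d → ℝ := fun i => s ^ (i.val + 1)

/-- The product of the differences of a family of points with the `i`-th one left out is the
Vandermonde determinant of the remaining points. -/
theorem prod_erase_sub_eq_det_vandermonde {R : Type*} [CommRing R] {n : ℕ}
    (t : Fin (n + 1) → R) (i : Fin (n + 1)) :
    ∏ ℓ ∈ univ.erase i, ∏ k ∈ (Iio ℓ).erase i, (t ℓ - t k) =
      (Matrix.vandermonde (t ∘ i.succAbove)).det := by
  have huniv : univ.erase i = univ.map i.succAboveEmb := by
    ext k
    simp [Fin.exists_succAbove_eq_iff]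
  have hIio : ∀ a : Fin n, (Iio (i.succAbove a)).erase i = (Iio a).map i.succAboveEmb := by
    intro a
    ext k
    refine Fin.succAboveCases i ?_ (fun b => ?_) k <;> simp
  rw [huniv, prod_map, Matrix.det_vandermonde]
  simp only [Fin.coe_succAboveEmb, hIio, prod_map, Function.comp_apply]
  exact prod_comm' (by simp)

/-- The alternating sum of the Vandermonde determinants obtained by leaving out one of at least
two points vanishes. -/
theorem sum_neg_one_pow_mul_det_vandermonde_succAbove {R : Type*} [CommRing R] {n : ℕ}
    (t : Fin (n + 2) → R) :
    ∑ i : Fin (n + 2), (-1 : R) ^ (i : ℕ) * (Matrix.vandermonde (t ∘ i.succAbove)).det = 0 := by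
  let A : Matrix (Fin (n + 2)) (Fin (n + 2)) R :=
    Matrix.of fun i => Fin.cons 1 fun j : Fin (n + 1) => t i ^ (j : ℕ)
  have hA : A.det = 0 :=
    Matrix.det_zero_of_column_eq (i := 0) (j := Fin.succ 0) (Fin.succ_ne_zero 0).symm
      fun i => by simp only [A, Matrix.of_apply, Fin.cons_zero, Fin.cons_succ, Fin.val_zero, pow_zero]
  rw [← hA, Matrix.det_succ_column_zero]
  refine sum_congr rfl fun i _ => ?_
  simp only [A, Matrix.of_apply, Fin.cons_zero, mul_one]
  congr 2

/-- The lower and upper triangulations of `C(d+2, d)` have the same total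
normalized volume: the sum of the Vandermonde products `V_i` over the odd
(`1`-based) indices equals the sum over the even indices. -/
theorem sum_odd_V_eq_sum_even_V (d : ℕ) (hd : 1 ≤ d)
    (t : Fin (d + 2) → ℝ) (ht : StrictMono t) (V : Fin (d + 2) → ℝ)
    (hV : ∀ i, V i = ∏ ℓ ∈ Finset.univ.erase i, ∏ k ∈ (Finset.Iio ℓ).erase i, (t ℓ - t k)) :
    ∑ i ∈ Finset.univ.filter (fun i : Fin (d + 2) => (i.val + 1) % 2 = 1), V i =
      ∑ i ∈ Finset.univ.filter (fun i : Fin (d + 2) => (i.val + 1) % 2 = 0), V i := by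
  have key : ∑ i : Fin (d + 2), (-1 : ℝ) ^ (i : ℕ) * V i = 0 := by
    simpa only [hV, prod_erase_sub_eq_det_vandermonde] using
      sum_neg_one_pow_mul_det_vandermonde_succAbove t
  have hodd : ∀ i : Fin (d + 2), ((i.val + 1) % 2 = 1) ↔ Even i.val := by
    intro i
    rw [Nat.even_iff]
    omega
  have heven : ∀ i : Fin (d + 2), ((i.val + 1) % 2 = 0) ↔ ¬ Even i.val := by
    intro i
    rw [Nat.even_iff]
    omega
  rw [filter_congr fun i _ => hodd i, filter_congr fun i _ => heven i]
  rw [← sum_filter_add_sum_filter_not univ (fun i : Fin (d + 2) => Even i.val)] at key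
  have hpos : ∑ i ∈ univ.filter (fun i : Fin (d + 2) => Even i.val), (-1 : ℝ) ^ (i : ℕ) * V i =
      ∑ i ∈ univ.filter (fun i : Fin (d + 2) => Even i.val), V i :=
    sum_congr rfl fun i hi => by rw [(mem_filter.1 hi).2.neg_one_pow, one_mul]
  have hneg : ∑ i ∈ univ.filter (fun i : Fin (d + 2) => ¬ Even i.val), (-1 : ℝ) ^ (i : ℕ) * V i =
      -∑ i ∈ univ.filter (fun i : Fin (d + 2) => ¬ Even i.val), V i := by
    rw [← sum_neg_distrib]
    exact sum_congr rfl fun i hi => by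
      rw [(Nat.not_even_iff_odd.1 (mem_filter.1 hi).2).neg_one_pow, neg_one_mul]
  linarith
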